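/- arXiv:1109.6705 — 10 statements merged into one kernel-verified Lean document; each statement's English description precedes it below -/
import Mathlib

section
/- Let R = ℤ[X]/(X² − 3X + 1) and let τ be the image of X in R. Let M be the 3×9 matrix over R whose columns are the nine vectors of the Grünbaum configuration. Then every 3×3 minor of M (the determinant of the submatrix on any three of the nine columns) belongs to the set {0, 1, −1, τ, −τ, τ−1, 1−τ, τ−2, 2−τ}; consequently every nonzero 3×3 minor of M is a unit of R, since τ·(3−τ) = 1 and (τ−1)·(τ−2) = 1 in R. -/
/-!
STATEMENT 1: In `R = ℤ[X]/(X² − 3X + 1)` with `τ` the image of `X`, every 3×3 minor of the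
3×9 matrix whose columns are the nine vectors of the Grünbaum configuration lies in
`{0, 1, −1, τ, −τ, τ−1, 1−τ, τ−2, 2−τ}`; consequently every nonzero such minor is a unit of `R`,
since `τ·(3−τ) = 1` and `(τ−1)·(τ−2) = 1` in `R`.
-/

open Polynomial

/-- The ring `R = ℤ[X]/(X² − 3X + 1)`. -/
abbrev GrunbaumRing : Type :=
  Polynomial ℤ ⧸ Ideal.span ({X ^ 2 - 3 * X + 1} : Set (Polynomial ℤ))

/-- `τ`, the image of `X` in `R`. -/
noncomputable def grunbaumTau : GrunbaumRing :=
  Ideal.Quotient.mk _ X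

/-- The 3×9 matrix over `R` whose columns are the nine vectors
`a = (1,0,0)`, `b = (0,1,0)`, `c = (0,0,1)`, `d = (1,1,1)`, `e = (2−τ,1−τ,1)`,
`f = (1,1,0)`, `g = (0,1−τ,1)`, `h = (1,0,1)`, `i = (1,τ,0)`
of the Grünbaum configuration. -/
noncomputable def grunbaumMatrix : Matrix (Fin 3) (Fin 9) GrunbaumRing :=
  let τ : GrunbaumRing := grunbaumTau
  !![1, 0, 0, 1, 2 - τ, 1, 0, 1, 1;
     0, 1, 0, 1, 1 - τ, 1, 1 - τ, 0, τ;
     0, 0, 1, 1, 1, 0, 1, 1, 0]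

theorem grunbaumTau_relation : grunbaumTau ^ 2 - 3 * grunbaumTau + 1 = 0 := by
  have h : Ideal.Quotient.mk (Ideal.span ({X ^ 2 - 3 * X + 1} : Set (Polynomial ℤ)))
      (X ^ 2 - 3 * X + 1) = 0 :=
    Ideal.Quotient.eq_zero_iff_mem.mpr (Ideal.mem_span_singleton_self _)
  exact h

/-- A model of `ℤ[X]/(X² − 3X + 1)` with decidable equality, with elements `x + y τ`. -/
abbrev GrunbaumModel : Type := QuadraticAlgebra ℤ (-1) 3

/-- The element of the model corresponding to `τ`. -/
def modelTau : GrunbaumModel := ⟨0, 1⟩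

/-- The Grünbaum configuration over the model ring. -/
def modelMatrix : Matrix (Fin 3) (Fin 9) GrunbaumModel :=
  let τ : GrunbaumModel := modelTau
  !![1, 0, 0, 1, 2 - τ, 1, 0, 1, 1;
     0, 1, 0, 1, 1 - τ, 1, 1 - τ, 0, τ;
     0, 0, 1, 1, 1, 0, 1, 1, 0]

/-- The homomorphism from the model ring sending `modelTau` to `grunbaumTau`. -/
noncomputable def modelHom : GrunbaumModel →ₐ[ℤ] GrunbaumRing :=
  QuadraticAlgebra.lift ⟨grunbaumTau, by
    simp only [zsmul_eq_mul]
    push_cast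
    linear_combination grunbaumTau_relation⟩

theorem modelHom_modelTau : modelHom modelTau = grunbaumTau := by
  simp [modelHom, modelTau, QuadraticAlgebra.lift]

theorem modelHom_two : modelHom 2 = 2 := by
  rw [show (2 : GrunbaumModel) = 1 + 1 by decide, map_add, map_one, one_add_one_eq_two]

theorem map_modelMatrix : modelMatrix.map modelHom = grunbaumMatrix := by
  ext i j
  fin_cases i <;> fin_cases j <;>
    simp [modelMatrix, grunbaumMatrix, modelHom_modelTau, modelHom_two]

theorem model_minors_mem (i j k : Fin 9) :
    (modelMatrix.submatrix id ![i, j, k]).det ∈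
      ([0, 1, -1, modelTau, -modelTau, modelTau - 1, 1 - modelTau, modelTau - 2,
        2 - modelTau] : List GrunbaumModel) := by
  rw [Matrix.det_fin_three]
  revert i j k
  decide +kernel

theorem grunbaum_minor_mem (c : Fin 3 → Fin 9) :
    (grunbaumMatrix.submatrix id c).det ∈
      ({0, 1, -1, grunbaumTau, -grunbaumTau, grunbaumTau - 1, 1 - grunbaumTau, grunbaumTau - 2,
        2 - grunbaumTau} : Set GrunbaumRing) := by
  have hc : c = ![c 0, c 1, c 2] := by
    ext i
    fin_cases i <;> rfl
  have hdet : (grunbaumMatrix.submatrix id c).det =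
      modelHom (modelMatrix.submatrix id c).det := by
    rw [AlgHom.map_det, ← map_modelMatrix]
    rfl
  have h := List.mem_map_of_mem (f := modelHom) (model_minors_mem (c 0) (c 1) (c 2))
  rw [← hc, ← hdet] at h
  simpa [modelHom_modelTau, modelHom_two] using h

theorem grunbaum_minors_are_units :
    let τ : GrunbaumRing := grunbaumTau
    (∀ c : Fin 3 → Fin 9, Function.Injective c →
        ((grunbaumMatrix.submatrix id c).det ∈
          ({0, 1, -1, τ, -τ, τ - 1, 1 - τ, τ - 2, 2 - τ} : Set GrunbaumRing))) ∧
    τ * (3 - τ) = 1 ∧ (τ - 1) * (τ - 2) = 1 ∧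
    (∀ c : Fin 3 → Fin 9, Function.Injective c →
        (grunbaumMatrix.submatrix id c).det ≠ 0 →
        IsUnit (grunbaumMatrix.submatrix id c).det) := by
  intro τ
  have hτ : τ ^ 2 - 3 * τ + 1 = 0 := grunbaumTau_relation
  have h₁ : τ * (3 - τ) = 1 := by linear_combination -hτ
  have h₂ : (τ - 1) * (τ - 2) = 1 := by linear_combination hτ
  refine ⟨fun c _ => grunbaum_minor_mem c, h₁, h₂, fun c _ hne => ?_⟩
  have hu : IsUnit τ := IsUnit.of_mul_eq_one _ h₁
  have hu₁ : IsUnit (τ - 1) := IsUnit.of_mul_eq_one _ h₂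
  have hu₂ : IsUnit (τ - 2) := IsUnit.of_mul_eq_one _ ((mul_comm _ _).trans h₂)
  rcases grunbaum_minor_mem c with h | h | h | h | h | h | h | h | h
  · exact absurd h hne
  all_goals rw [h]
  · exact isUnit_one
  · exact (isUnit_one (M := GrunbaumRing)).neg
  · exact hu
  · exact hu.neg
  · exact hu₁
  · simpa using hu₁.neg
  · exact hu₂
  · simpa using hu₂.neg
end

section
/- Let K be a field of characteristic 0 and let τ ∈ K satisfy τ² − 3τ + 1 = 0. Consider the quadratic forms q₁ = XY − τ·XZ + (τ−1)·YZ and q₂ = (τ−2)Y² + Z² − (τ−1)·XY − XZ + YZ in K[X,Y,Z]. Then q₁ and q₂ are nondegenerate quadratic forms (their associated symmetric 3×3 matrices are invertible), and among the nine points of the Grünbaum configuration: q₁ vanishes at a, b, c, d, e and at none of f, g, h, i; q₂ vanishes at a, d, e, h, i and at none of b, c, f, g. -/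
/-!
STATEMENT 3: Over a field `K` of characteristic 0 with `τ² − 3τ + 1 = 0`, the quadratic forms
`q₁ = XY − τXZ + (τ−1)YZ` and `q₂ = (τ−2)Y² + Z² − (τ−1)XY − XZ + YZ` are nondegenerate
(their associated symmetric 3×3 matrices are invertible), `q₁` vanishes at `a,b,c,d,e` of the
Grünbaum configuration and at none of `f,g,h,i`, and `q₂` vanishes at `a,d,e,h,i` and at none of
`b,c,f,g`.
-/

open MvPolynomial

noncomputable def grunQ1 (K : Type*) [Field K] (τ : K) : MvPolynomial (Fin 3) K :=
  X 0 * X 1 - C τ * (X 0 * X 2) + C (τ - 1) * (X 1 * X 2)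

noncomputable def grunQ2 (K : Type*) [Field K] (τ : K) : MvPolynomial (Fin 3) K :=
  C (τ - 2) * X 1 ^ 2 + X 2 ^ 2 - C (τ - 1) * (X 0 * X 1) - X 0 * X 2 + X 1 * X 2

/-- The symmetric matrix associated to a quadratic form `q` in three variables:
`A i j = (1/2)·∂i∂j q` (a constant polynomial, evaluated at `0`). -/
noncomputable def assocMatrix {K : Type*} [Field K] (q : MvPolynomial (Fin 3) K) :
    Matrix (Fin 3) (Fin 3) K :=
  fun i j => (2 : K)⁻¹ * eval (fun _ => 0) (pderiv i (pderiv j q))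

theorem assocMatrix_grunQ1 {K : Type*} [Field K] (τ : K) :
    assocMatrix (grunQ1 K τ) =
      (2 : K)⁻¹ • !![0, 1, -τ; 1, 0, τ - 1; -τ, τ - 1, 0] := by
  ext i j
  fin_cases i <;> fin_cases j <;> simp [assocMatrix, grunQ1, pderiv_X]

theorem assocMatrix_grunQ2 {K : Type*} [Field K] (τ : K) :
    assocMatrix (grunQ2 K τ) =
      (2 : K)⁻¹ • !![0, 1 - τ, -1; 1 - τ, 2 * (τ - 2), 1; -1, 1, 2] := by
  ext i j
  fin_cases i <;> fin_cases j <;>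
    simp [assocMatrix, grunQ2, pderiv_X, map_ofNat constantCoeff, mul_comm]

theorem det_assocMatrix_grunQ1 {K : Type*} [Field K] (τ : K) :
    (assocMatrix (grunQ1 K τ)).det = (2 : K)⁻¹ ^ 3 * (-2 * τ * (τ - 1)) := by
  rw [assocMatrix_grunQ1, Matrix.det_smul, Matrix.det_fin_three]
  simp
  ring

theorem det_assocMatrix_grunQ2 {K : Type*} [Field K] (τ : K) :
    (assocMatrix (grunQ2 K τ)).det = (2 : K)⁻¹ ^ 3 * (-2 * τ * (τ - 2)) := by
  rw [assocMatrix_grunQ2, Matrix.det_smul, Matrix.det_fin_three]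
  simp
  ring

theorem eval_grunQ1 {K : Type*} [Field K] (τ x y z : K) :
    eval ![x, y, z] (grunQ1 K τ) = x * y - τ * (x * z) + (τ - 1) * (y * z) := by
  simp [grunQ1]

theorem eval_grunQ2 {K : Type*} [Field K] (τ x y z : K) :
    eval ![x, y, z] (grunQ2 K τ) =
      (τ - 2) * y ^ 2 + z ^ 2 - (τ - 1) * (x * y) - x * z + y * z := by
  simp [grunQ2]

theorem grunbaum_conics_nondegenerate_and_incidences
    (K : Type*) [Field K] [CharZero K] (τ : K) (hτ : τ ^ 2 - 3 * τ + 1 = 0) :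
    -- the nine points
    let a : Fin 3 → K := ![1, 0, 0]
    let b : Fin 3 → K := ![0, 1, 0]
    let c : Fin 3 → K := ![0, 0, 1]
    let d : Fin 3 → K := ![1, 1, 1]
    let e : Fin 3 → K := ![2 - τ, 1 - τ, 1]
    let f : Fin 3 → K := ![1, 1, 0]
    let g : Fin 3 → K := ![0, 1 - τ, 1]
    let h : Fin 3 → K := ![1, 0, 1]
    let i : Fin 3 → K := ![1, τ, 0]
    -- nondegeneracy
    (assocMatrix (grunQ1 K τ)).det ≠ 0 ∧ (assocMatrix (grunQ2 K τ)).det ≠ 0 ∧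
    -- q₁ vanishes at a, b, c, d, e and at none of f, g, h, i
    eval a (grunQ1 K τ) = 0 ∧ eval b (grunQ1 K τ) = 0 ∧ eval c (grunQ1 K τ) = 0 ∧
    eval d (grunQ1 K τ) = 0 ∧ eval e (grunQ1 K τ) = 0 ∧
    eval f (grunQ1 K τ) ≠ 0 ∧ eval g (grunQ1 K τ) ≠ 0 ∧
    eval h (grunQ1 K τ) ≠ 0 ∧ eval i (grunQ1 K τ) ≠ 0 ∧
    -- q₂ vanishes at a, d, e, h, i and at none of b, c, f, g
    eval a (grunQ2 K τ) = 0 ∧ eval d (grunQ2 K τ) = 0 ∧ eval e (grunQ2 K τ) = 0 ∧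
    eval h (grunQ2 K τ) = 0 ∧ eval i (grunQ2 K τ) = 0 ∧
    eval b (grunQ2 K τ) ≠ 0 ∧ eval c (grunQ2 K τ) ≠ 0 ∧
    eval f (grunQ2 K τ) ≠ 0 ∧ eval g (grunQ2 K τ) ≠ 0 := by
  have h0 : τ ≠ 0 := by rintro rfl; simp at hτ
  have h1 : τ - 1 ≠ 0 := fun h => one_ne_zero (α := K) (by linear_combination (τ - 2) * h - hτ)
  have h2 : τ - 2 ≠ 0 := fun h => one_ne_zero (α := K) (by linear_combination (τ - 1) * h - hτ)
  have half : (2 : K)⁻¹ ^ 3 ≠ 0 := by simp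
  have hneg : (-2 : K) ≠ 0 := by simp
  intro a b c d e f g h i
  simp only [a, b, c, d, e, f, g, h, i, det_assocMatrix_grunQ1, det_assocMatrix_grunQ2,
    eval_grunQ1, eval_grunQ2]
  refine ⟨mul_ne_zero half (mul_ne_zero (mul_ne_zero hneg h0) h1),
    mul_ne_zero half (mul_ne_zero (mul_ne_zero hneg h0) h2),
    by ring, by ring, by ring, by ring, by linear_combination hτ,
    by simp, fun H => ?_, by simpa using h0, by simpa using h0,
    by ring, by ring, by ring, by ring, by linear_combination τ * hτ,
    by simpa using h2, by simp, fun H => ?_, fun H => ?_⟩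
  · exact mul_ne_zero h1 h1 (by linear_combination -H)
  · exact one_ne_zero (α := K) (by linear_combination -H)
  · exact one_ne_zero (α := K) (by linear_combination H - (τ - 1) * hτ)
end

section
/- Let K be an algebraically closed field of characteristic 0 and let τ ∈ K satisfy τ² − 3τ + 1 = 0. Let C₁ ⊆ ℙ²(K) be the zero locus of q₁ = XY − τ·XZ + (τ−1)·YZ and C₂ the zero locus of q₂ = (τ−2)Y² + Z² − (τ−1)·XY − XZ + YZ. Then C₁ ∩ C₂ consists of exactly the four pairwise distinct points a = (1:0:0), d = (1:1:1), e = (2−τ : 1−τ : 1), and p = (1 : 2(τ−1) : 2(2−τ)). -/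
/-!
STATEMENT 4: Over an algebraically closed field `K` of characteristic 0 with `τ² − 3τ + 1 = 0`,
the intersection of the conics `C₁ = {q₁ = 0}` and `C₂ = {q₂ = 0}` in `ℙ²(K)` consists of exactly
the four pairwise distinct points `a = (1:0:0)`, `d = (1:1:1)`, `e = (2−τ : 1−τ : 1)` and
`p = (1 : 2(τ−1) : 2(2−τ))`.
-/

open MvPolynomial

lemma vec3_ne_zero_of_coord {K : Type*} [Field K] (v : Fin 3 → K) (j : Fin 3)
    (h : v j ≠ 0) : v ≠ 0 :=
  fun hv => h (by rw [hv]; rfl)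

theorem grunbaum_conics_intersection
    (K : Type*) [Field K] [IsAlgClosed K] [CharZero K] (τ : K)
    (hτ : τ ^ 2 - 3 * τ + 1 = 0) :
    let A : Projectivization K (Fin 3 → K) := Projectivization.mk K (![1, 0, 0] : Fin 3 → K)
      (vec3_ne_zero_of_coord _ 0 one_ne_zero)
    let D : Projectivization K (Fin 3 → K) := Projectivization.mk K (![1, 1, 1] : Fin 3 → K)
      (vec3_ne_zero_of_coord _ 0 one_ne_zero)
    let E : Projectivization K (Fin 3 → K) := Projectivization.mk K
      (![2 - τ, 1 - τ, 1] : Fin 3 → K)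
      (vec3_ne_zero_of_coord _ 2 one_ne_zero)
    let P : Projectivization K (Fin 3 → K) := Projectivization.mk K
      (![1, 2 * (τ - 1), 2 * (2 - τ)] : Fin 3 → K)
      (vec3_ne_zero_of_coord _ 0 one_ne_zero)
    -- the four points are pairwise distinct …
    (A ≠ D ∧ A ≠ E ∧ A ≠ P ∧ D ≠ E ∧ D ≠ P ∧ E ≠ P) ∧
    -- … and `C₁ ∩ C₂` consists exactly of them
    ∀ Q : Projectivization K (Fin 3 → K),
      (eval Q.rep (grunQ1 K τ) = 0 ∧ eval Q.rep (grunQ2 K τ) = 0) ↔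
        (Q = A ∨ Q = D ∨ Q = E ∨ Q = P) := by
  intro A D E P
  have hτ0 : τ ≠ 0 := fun h => by simp [h] at hτ
  have hτ1 : τ - 1 ≠ 0 := fun h => one_ne_zero (α := K) (by grind)
  have hτ2 : τ - 2 ≠ 0 := fun h => one_ne_zero (α := K) (by grind)
  have h12 : 1 - 2 * τ ≠ 0 := fun h => one_ne_zero (α := K) (by grind)
  refine ⟨⟨?_, ?_, ?_, ?_, ?_, ?_⟩, fun Q => ?_⟩
  iterate 6
    intro h
    rw [Projectivization.mk_eq_mk_iff'] at h
    obtain ⟨a, ha⟩ := h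
    have e0 := congrFun ha 0
    have e1 := congrFun ha 1
    have e2 := congrFun ha 2
    simp at e0 e1 e2
    grind
  have hQ (w : Fin 3 → K) (hw : w ≠ 0) :
      Q = Projectivization.mk K w hw ↔
        ∃ t : K, t * w 0 = Q.rep 0 ∧ t * w 1 = Q.rep 1 ∧ t * w 2 = Q.rep 2 := by
    conv_lhs => rw [← Q.mk_rep, Projectivization.mk_eq_mk_iff']
    simp [funext_iff, Fin.forall_fin_succ]
  simp only [A, D, E, P, hQ, grunQ1, grunQ2, map_add, map_sub, map_mul, map_pow, eval_X, eval_C,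
    Matrix.cons_val]
  generalize Q.rep 0 = x
  generalize Q.rep 1 = y
  generalize Q.rep 2 = z
  constructor
  · rintro ⟨h₁, h₂⟩
    by_cases hz : z = 0
    · subst hz
      by_cases hy : y = 0
      · exact Or.inl ⟨x, by simp [hy]⟩
      · exfalso
        have hx : x = 0 := by simpa [hy] using h₁
        simp [hx, hy, hτ2] at h₂
    have hprod : (τ - 2) * ((y - z) * ((y - (1 - τ) * z) * (y + τ * z))) = 0 := by
      grind
    rcases mul_eq_zero.1 ((mul_eq_zero.1 hprod).resolve_left hτ2) with h | h
    · have hx : (τ - 1) * z * (x - z) = 0 := by grind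
      have hx' := (mul_eq_zero.1 hx).resolve_left (mul_ne_zero hτ1 hz)
      exact Or.inr (Or.inl ⟨z, by grind, by grind, by grind⟩)
    rcases mul_eq_zero.1 h with h | h
    · have hx : (1 - 2 * τ) * z * (x - (2 - τ) * z) = 0 := by grind
      have hx' := (mul_eq_zero.1 hx).resolve_left (mul_ne_zero h12 hz)
      exact Or.inr (Or.inr (Or.inl ⟨z, by grind, by grind, by grind⟩))
    · have hx : τ * z * (2 * x + (τ - 1) * z) = 0 := by grind
      have hx' := (mul_eq_zero.1 hx).resolve_left (mul_ne_zero hτ0 hz)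
      have hz' : z = 2 * (2 - τ) * x := by grind
      exact Or.inr (Or.inr (Or.inr ⟨x, by grind, by grind, by grind⟩))
  · rintro (⟨t, rfl, rfl, rfl⟩ | ⟨t, rfl, rfl, rfl⟩ | ⟨t, rfl, rfl, rfl⟩ | ⟨t, rfl, rfl, rfl⟩) <;>
      constructor <;> grind
end

section
/- Over ℚ, consider the quadratic forms q₁ = 2XY − 3XZ + YZ and q₂ = (3/4)Y² + Z² + (3/4)XY − XZ − (3/2)YZ, and the points a' = (1:0:0), b' = (0:1:0), c' = (0:0:1), d' = (1:1:1), e' = (−2:2:1), h' = (1:0:1), i' = (1:−1:0) in ℙ²(ℚ). Then: (i) q₁ and q₂ are nondegenerate quadratic forms; (ii) q₁ vanishes at a', b', c', d', e'; (iii) q₂ vanishes at a', d', e', h', i'; (iv) the gradient vectors of q₁ and q₂ at (1,1,1) are nonzero and proportional, i.e., the two conics are tangent at d'; (v) over an algebraic closure of ℚ, the common zero locus of q₁ and q₂ in the projective plane is exactly the three points a', d', e'. -/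
/-!
STATEMENT 6: Over ℚ, the quadratic forms `q₁ = 2XY − 3XZ + YZ` and
`q₂ = (3/4)Y² + Z² + (3/4)XY − XZ − (3/2)YZ` are nondegenerate, `q₁` vanishes at
`a',b',c',d',e'`, `q₂` vanishes at `a',d',e',h',i'`, the two conics are tangent at `d' = (1:1:1)`
(their gradients there are nonzero and proportional), and over an algebraic closure of ℚ the common
zero locus of `q₁` and `q₂` in the projective plane is exactly the three points `a', d', e'`,
where `a' = (1:0:0)`, `b' = (0:1:0)`, `c' = (0:0:1)`, `d' = (1:1:1)`, `e' = (−2:2:1)`,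
`h' = (1:0:1)`, `i' = (1:−1:0)`.
-/

open MvPolynomial

noncomputable def tanQ1 (K : Type*) [Field K] : MvPolynomial (Fin 3) K :=
  C 2 * (X 0 * X 1) - C 3 * (X 0 * X 2) + X 1 * X 2

noncomputable def tanQ2 (K : Type*) [Field K] : MvPolynomial (Fin 3) K :=
  C (3 / 4) * X 1 ^ 2 + X 2 ^ 2 + C (3 / 4) * (X 0 * X 1) - X 0 * X 2
    - C (3 / 2) * (X 1 * X 2)

/-- The gradient vector of `q` at the point `pt`. -/
noncomputable def gradAt {K : Type*} [Field K] (q : MvPolynomial (Fin 3) K)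
    (pt : Fin 3 → K) : Fin 3 → K :=
  fun i => eval pt (pderiv i q)

lemma eval_tanQ1 {K : Type*} [Field K] (v : Fin 3 → K) :
    eval v (tanQ1 K) = 2 * (v 0 * v 1) - 3 * (v 0 * v 2) + v 1 * v 2 := by
  simp only [tanQ1, map_add, map_sub, map_mul, eval_C, eval_X]

lemma eval_tanQ2 {K : Type*} [Field K] (v : Fin 3 → K) :
    eval v (tanQ2 K) = 3 / 4 * v 1 ^ 2 + v 2 ^ 2 + 3 / 4 * (v 0 * v 1) - v 0 * v 2
      - 3 / 2 * (v 1 * v 2) := by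
  simp only [tanQ2, map_add, map_sub, map_mul, map_pow, eval_C, eval_X]

lemma assocMatrix_tanQ1 :
    assocMatrix (tanQ1 ℚ) = !![0, 1, -3 / 2; 1, 0, 1 / 2; -3 / 2, 1 / 2, 0] := by
  ext i j
  fin_cases i <;> fin_cases j <;>
    simp [assocMatrix, tanQ1, pderiv_X] <;> norm_num

lemma assocMatrix_tanQ2 :
    assocMatrix (tanQ2 ℚ) =
      !![0, 3 / 8, -1 / 2; 3 / 8, 3 / 4, -3 / 4; -1 / 2, -3 / 4, 1] := by
  ext i j
  fin_cases i <;> fin_cases j <;>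
    simp [assocMatrix, tanQ2, sq, pderiv_X] <;> norm_num

lemma gradAt_tanQ1 : gradAt (tanQ1 ℚ) ![1, 1, 1] = ![-1, 3, -2] := by
  ext i
  fin_cases i <;> simp [gradAt, tanQ1, pderiv_X] <;> norm_num

lemma gradAt_tanQ2 : gradAt (tanQ2 ℚ) ![1, 1, 1] = ![-1 / 4, 3 / 4, -1 / 2] := by
  ext i
  fin_cases i <;> simp [gradAt, tanQ2, pderiv_X] <;> norm_num

/-- The common zeros of the two conics are the multiples of three vectors, one for each point
of intersection. -/
lemma tanQ_common_zero_iff {K : Type*} [Field K] [CharZero K] (v : Fin 3 → K) :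
    (eval v (tanQ1 K) = 0 ∧ eval v (tanQ2 K) = 0) ↔
      (∃ a : K, a • ![1, 0, 0] = v) ∨ (∃ a : K, a • ![1, 1, 1] = v) ∨
        ∃ a : K, a • ![-2, 2, 1] = v := by
  rw [eval_tanQ1, eval_tanQ2]
  constructor
  · rintro ⟨h1, h2⟩
    have hres : 6 * ((v 1 - v 2) ^ 2 * (v 1 - 2 * v 2)) = 0 := by
      linear_combination 4 * (2 * v 1 - 3 * v 2) * h2 - (3 * v 1 - 4 * v 2) * h1
    have hline : v 1 = v 2 ∨ v 1 = 2 * v 2 := by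
      simpa [sub_eq_zero] using hres
    by_cases hz : v 2 = 0
    · refine Or.inl ⟨v 0, ?_⟩
      have hy : v 1 = 0 := by rcases hline with h | h <;> simp [h, hz]
      ext i
      fin_cases i <;> simp [hy, hz]
    · rcases hline with hy | hy
      · refine Or.inr (Or.inl ⟨v 2, ?_⟩)
        have hx : v 0 = v 2 := by
          apply mul_right_cancel₀ hz
          rw [hy] at h1
          linear_combination -h1
        ext i
        fin_cases i <;> simp [hx, hy]
      · refine Or.inr (Or.inr ⟨v 2, ?_⟩)
        have hx : v 0 = -2 * v 2 := by
          apply mul_right_cancel₀ hz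
          rw [hy] at h1
          linear_combination h1
        ext i
        fin_cases i <;> simp [hx, hy, mul_comm]
  · rintro (⟨a, rfl⟩ | ⟨a, rfl⟩ | ⟨a, rfl⟩) <;> simp <;> constructor <;> ring

theorem two_tangent_conics_over_Q :
    -- (i) nondegeneracy
    (assocMatrix (tanQ1 ℚ)).det ≠ 0 ∧ (assocMatrix (tanQ2 ℚ)).det ≠ 0 ∧
    -- (ii) q₁ vanishes at a', b', c', d', e'
    eval (![1, 0, 0] : Fin 3 → ℚ) (tanQ1 ℚ) = 0 ∧
    eval (![0, 1, 0] : Fin 3 → ℚ) (tanQ1 ℚ) = 0 ∧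
    eval (![0, 0, 1] : Fin 3 → ℚ) (tanQ1 ℚ) = 0 ∧
    eval (![1, 1, 1] : Fin 3 → ℚ) (tanQ1 ℚ) = 0 ∧
    eval (![-2, 2, 1] : Fin 3 → ℚ) (tanQ1 ℚ) = 0 ∧
    -- (iii) q₂ vanishes at a', d', e', h', i'
    eval (![1, 0, 0] : Fin 3 → ℚ) (tanQ2 ℚ) = 0 ∧
    eval (![1, 1, 1] : Fin 3 → ℚ) (tanQ2 ℚ) = 0 ∧
    eval (![-2, 2, 1] : Fin 3 → ℚ) (tanQ2 ℚ) = 0 ∧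
    eval (![1, 0, 1] : Fin 3 → ℚ) (tanQ2 ℚ) = 0 ∧
    eval (![1, -1, 0] : Fin 3 → ℚ) (tanQ2 ℚ) = 0 ∧
    -- (iv) the two conics are tangent at d' = (1:1:1)
    gradAt (tanQ1 ℚ) ![1, 1, 1] ≠ 0 ∧ gradAt (tanQ2 ℚ) ![1, 1, 1] ≠ 0 ∧
    (∃ c : ℚ, c ≠ 0 ∧ gradAt (tanQ2 ℚ) ![1, 1, 1] = c • gradAt (tanQ1 ℚ) ![1, 1, 1]) ∧
    -- (v) over an algebraic closure of ℚ, the common zero locus is exactly {a', d', e'}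
    (let K := AlgebraicClosure ℚ
     let A : Projectivization K (Fin 3 → K) := Projectivization.mk K (![1, 0, 0] : Fin 3 → K)
       (vec3_ne_zero_of_coord _ 0 one_ne_zero)
     let D : Projectivization K (Fin 3 → K) := Projectivization.mk K (![1, 1, 1] : Fin 3 → K)
       (vec3_ne_zero_of_coord _ 0 one_ne_zero)
     let E : Projectivization K (Fin 3 → K) := Projectivization.mk K (![-2, 2, 1] : Fin 3 → K)
       (vec3_ne_zero_of_coord _ 2 one_ne_zero)
     (A ≠ D ∧ A ≠ E ∧ D ≠ E) ∧
     ∀ Q : Projectivization K (Fin 3 → K),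
       (eval Q.rep (tanQ1 K) = 0 ∧ eval Q.rep (tanQ2 K) = 0) ↔
         (Q = A ∨ Q = D ∨ Q = E)) := by
  refine ⟨?_, ?_, ?_, ?_, ?_, ?_, ?_, ?_, ?_, ?_, ?_, ?_, ?_, ?_, ?_, ?_⟩
  · rw [assocMatrix_tanQ1, Matrix.det_fin_three]
    simp
    norm_num
  · rw [assocMatrix_tanQ2, Matrix.det_fin_three]
    simp
    norm_num
  iterate 5
    · rw [eval_tanQ1]
      simp <;> norm_num
  iterate 5
    · rw [eval_tanQ2]
      simp <;> norm_num
  · rw [gradAt_tanQ1]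
    exact vec3_ne_zero_of_coord _ 0 (by norm_num)
  · rw [gradAt_tanQ2]
    exact vec3_ne_zero_of_coord _ 0 (by norm_num)
  · refine ⟨1 / 4, by norm_num, ?_⟩
    rw [gradAt_tanQ1, gradAt_tanQ2]
    ext i
    fin_cases i <;> norm_num
  · intro K A D E
    refine ⟨⟨?_, ?_, ?_⟩, fun Q => ?_⟩
    · rw [Ne, Projectivization.mk_eq_mk_iff']
      rintro ⟨a, ha⟩
      have h0 := congrFun ha 0
      have h1 := congrFun ha 1
      simp_all
    · rw [Ne, Projectivization.mk_eq_mk_iff']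
      rintro ⟨a, ha⟩
      have h0 := congrFun ha 0
      have h2 := congrFun ha 2
      simp_all
    · rw [Ne, Projectivization.mk_eq_mk_iff']
      rintro ⟨a, ha⟩
      have h1 := congrFun ha 1
      have h2 := congrFun ha 2
      simp_all
    · rw [tanQ_common_zero_iff, ← Projectivization.mk_eq_mk_iff' K _ _ Q.rep_nonzero,
        ← Projectivization.mk_eq_mk_iff' K _ _ Q.rep_nonzero,
        ← Projectivization.mk_eq_mk_iff' K _ _ Q.rep_nonzero, Q.mk_rep]
end

section
/- Let k be a field of characteristic 0 and let ω ∈ k be a primitive cube root of unity. For each of the nine lines of the dual Hesse configuration, take its four points in the following order: (p,P₁,b,γ), (p,P₂,c,β), (p,P₃,a,α), (n,γ,a,P₂), (n,β,b,P₃), (n,α,c,P₁), (m,P₁,P₂,P₃), (m,γ,β,α), (m,b,c,a). Then the cross-ratio of each of these nine ordered quadruples of collinear points equals one and the same value λ = −ω; in particular λ satisfies λ² − λ + 1 = 0, so the common cross-ratio is a primitive sixth root of unity. -/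
/-!
STATEMENT 10: For a field `k` of characteristic 0 and `ω` a primitive cube root of unity, the
cross-ratio of each of the nine ordered quadruples of collinear points of the dual Hesse
configuration `(p,P₁,b,γ), (p,P₂,c,β), (p,P₃,a,α), (n,γ,a,P₂), (n,β,b,P₃), (n,α,c,P₁),
(m,P₁,P₂,P₃), (m,γ,β,α), (m,b,c,a)` equals `−ω`, computed (for any auxiliary vector `e` outside
the plane spanned by the quadruple) using
`cr(v₁,v₂,v₃,v₄) = (det(v₁,v₄,e)·det(v₃,v₂,e)) / (det(v₁,v₂,e)·det(v₃,v₄,e))`;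
and `λ = −ω` satisfies `λ² − λ + 1 = 0` (a primitive sixth root of unity).
Indices: m=0, n=1, p=2, a=3, b=4, c=5, P₁=6, P₂=7, P₃=8, α=9, β=10, γ=11.
-/

/-- The twelve points of the dual Hesse configuration, as vectors in `k³`. -/
def dualHessePts (k : Type*) [Field k] (ω : k) : Fin 12 → (Fin 3 → k) :=
  ![![1, 0, 0], ![0, 0, 1], ![0, 1, 0],
    ![ω, ω, 1], ![1, ω, 1], ![ω ^ 2, ω, 1],
    ![1, ω ^ 2, 1], ![ω ^ 2, ω ^ 2, 1], ![ω, ω ^ 2, 1],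
    ![ω, 1, 1], ![ω ^ 2, 1, 1], ![1, 1, 1]]

/-- The nine ordered quadruples of collinear points. -/
def dualHesseQuads : Fin 9 → Fin 4 → Fin 12 :=
  ![![2, 6, 4, 11],  -- (p, P₁, b, γ)
    ![2, 7, 5, 10],  -- (p, P₂, c, β)
    ![2, 8, 3, 9],   -- (p, P₃, a, α)
    ![1, 11, 3, 7],  -- (n, γ, a, P₂)
    ![1, 10, 4, 8],  -- (n, β, b, P₃)
    ![1, 9, 5, 6],   -- (n, α, c, P₁)
    ![0, 6, 7, 8],   -- (m, P₁, P₂, P₃)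
    ![0, 11, 10, 9], -- (m, γ, β, α)
    ![0, 4, 5, 3]]   -- (m, b, c, a)

/-- The determinant of the 3×3 matrix with rows `u`, `v`, `w`. -/
def det3 {k : Type*} [Field k] (u v w : Fin 3 → k) : k :=
  (Matrix.of ![u, v, w]).det

/-- The cross-ratio of four collinear points of `ℙ²(k)` with representative vectors
`v₁, v₂, v₃, v₄`, computed with the help of an auxiliary vector `e` not in the plane of the
line. -/
def crossRatioDet {k : Type*} [Field k] (v₁ v₂ v₃ v₄ e : Fin 3 → k) : k :=
  (det3 v₁ v₄ e * det3 v₃ v₂ e) / (det3 v₁ v₂ e * det3 v₃ v₄ e)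

theorem det3_ne_zero {k : Type*} [Field k] {u v e : Fin 3 → k}
    (huv : LinearIndependent k ![u, v]) (he : e ∉ Submodule.span k {u, v}) :
    det3 u v e ≠ 0 := by
  have hli : LinearIndependent k ![e, u, v] :=
    linearIndependent_finCons.2 ⟨huv, by simpa [Matrix.range_cons, Set.pair_comm] using he⟩
  have hdet : (Matrix.of ![e, u, v]).det ≠ 0 :=
    ((Matrix.isUnit_iff_isUnit_det _).1
      (Matrix.linearIndependent_rows_iff_isUnit.1 hli)).ne_zero
  convert hdet using 1
  simp only [det3, Matrix.det_fin_three, Matrix.of_apply, Matrix.cons_val]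
  ring

/-- The cross-ratio of `u`, `v`, `a u + b v`, `c u + d v` is `ad / (ad - bc)`. -/
theorem crossRatioDet_of_combination {k : Type*} [Field k] {u v e : Fin 3 → k}
    (huv : LinearIndependent k ![u, v]) (he : e ∉ Submodule.span k {u, v}) (a b c d : k) :
    crossRatioDet u v (a • u + b • v) (c • u + d • v) e = a * d / (a * d - b * c) := by
  have hD := det3_ne_zero huv he
  have h₁₄ : det3 u (c • u + d • v) e = d * det3 u v e := by
    simp [det3, Matrix.det_fin_three]; ring
  have h₃₂ : det3 (a • u + b • v) v e = a * det3 u v e := by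
    simp [det3, Matrix.det_fin_three]; ring
  have h₃₄ : det3 (a • u + b • v) (c • u + d • v) e = (a * d - b * c) * det3 u v e := by
    simp [det3, Matrix.det_fin_three]; ring
  rw [crossRatioDet, h₁₄, h₃₂, h₃₄,
    show d * det3 u v e * (a * det3 u v e) = a * d * (det3 u v e * det3 u v e) by ring,
    show det3 u v e * ((a * d - b * c) * det3 u v e) =
      (a * d - b * c) * (det3 u v e * det3 u v e) by ring,
    mul_div_mul_right _ _ (mul_ne_zero hD hD)]

/-- Each quadruple is `u, v, a u + b v, c u + d v` with `ad / (ad - bc) = -ω`. -/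
theorem dualHesseQuads_combination {k : Type*} [Field k] {ω : k}
    (hω1 : ω ≠ 1) (hω : ω ^ 2 + ω + 1 = 0) (j : Fin 9) :
    LinearIndependent k ![dualHessePts k ω (dualHesseQuads j 0),
      dualHessePts k ω (dualHesseQuads j 1)] ∧
    ∃ a b c d : k,
      dualHessePts k ω (dualHesseQuads j 2) =
        a • dualHessePts k ω (dualHesseQuads j 0) + b • dualHessePts k ω (dualHesseQuads j 1) ∧
      dualHessePts k ω (dualHesseQuads j 3) =
        c • dualHessePts k ω (dualHesseQuads j 0) + d • dualHessePts k ω (dualHesseQuads j 1) ∧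
      a * d / (a * d - b * c) = -ω := by
  have hω0 : ω ≠ 0 := by rintro rfl; simp at hω
  have h1 : ω - 1 ≠ 0 := sub_ne_zero.2 hω1
  have h3 : ω ^ 3 = 1 := by linear_combination (ω - 1) * hω
  constructor
  · rw [LinearIndependent.pair_iff]
    intro s t h
    have e0 := congrFun h 0
    have e1 := congrFun h 1
    have e2 := congrFun h 2
    fin_cases j <;> simp [dualHessePts, dualHesseQuads] at e0 e1 e2 <;> simp_all
  · have hp : (ω - ω ^ 2) * 1 / ((ω - ω ^ 2) * 1 - 1 * (1 - ω ^ 2)) = -ω := by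
      rw [show (ω - ω ^ 2) * 1 - 1 * (1 - ω ^ 2) = ω - 1 by ring, div_eq_iff h1]
      ring
    have hm : (ω ^ 2 - 1) * 1 / ((ω ^ 2 - 1) * 1 - 1 * (ω - 1)) = -ω := by
      rw [show (ω ^ 2 - 1) * 1 - 1 * (ω - 1) = ω * (ω - 1) by ring,
        div_eq_iff (mul_ne_zero hω0 h1)]
      linear_combination h3
    have hn : (1 - ω) * ω ^ 2 / ((1 - ω) * ω ^ 2 - ω * (1 - ω ^ 2)) = -ω := by
      rw [show (1 - ω) * ω ^ 2 - ω * (1 - ω ^ 2) = ω * (ω - 1) by ring,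
        div_eq_iff (mul_ne_zero hω0 h1)]
      ring
    have key : ∀ {a b c d : k} {u v w x : Fin 3 → k}, w = a • u + b • v → x = c • u + d • v →
        a * d / (a * d - b * c) = -ω → ∃ a b c d : k, w = a • u + b • v ∧
          x = c • u + d • v ∧ a * d / (a * d - b * c) = -ω :=
      fun hw hx h => ⟨_, _, _, _, hw, hx, h⟩
    fin_cases j
    iterate 3
      refine key ?_ ?_ hp <;> ext i <;> fin_cases i <;> simp [dualHessePts, dualHesseQuads]
    iterate 3
      refine key ?_ ?_ hn <;> ext i <;> fin_cases i <;> simp [dualHessePts, dualHesseQuads] <;>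
        grind
    all_goals
      refine key ?_ ?_ hm <;> ext i <;> fin_cases i <;> simp [dualHessePts, dualHesseQuads]

theorem dualHesse_cross_ratios (k : Type*) [Field k] [CharZero k] (ω : k)
    (hω1 : ω ≠ 1) (hω : ω ^ 2 + ω + 1 = 0) :
    (∀ j : Fin 9, ∀ e : Fin 3 → k,
      e ∉ Submodule.span k (Set.range fun i : Fin 4 => dualHessePts k ω (dualHesseQuads j i)) →
      crossRatioDet (dualHessePts k ω (dualHesseQuads j 0))
        (dualHessePts k ω (dualHesseQuads j 1))
        (dualHessePts k ω (dualHesseQuads j 2))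
        (dualHessePts k ω (dualHesseQuads j 3)) e = -ω) ∧
    (-ω) ^ 2 - (-ω) + 1 = 0 := by
  refine ⟨fun j e he => ?_, by linear_combination hω⟩
  obtain ⟨hli, a, b, c, d, h₂, h₃, h⟩ := dualHesseQuads_combination hω1 hω j
  rw [h₂, h₃, crossRatioDet_of_combination hli _ a b c d, h]
  refine fun hmem => he (Submodule.span_mono ?_ hmem)
  rintro _ (rfl | rfl)
  exacts [⟨0, rfl⟩, ⟨1, rfl⟩]
end

section
/- In the projective plane ℙ²(𝔽₃) over the field with three elements, consider the twelve points m = (1:0:0), n = (1:1:0), p = (0:1:0), a = (1:1:1), b = (0:1:1), c = (2:1:1), P₁ = (0:2:1), P₂ = (2:2:1), P₃ = (1:2:1), α = (1:0:1), β = (2:0:1), γ = (0:0:1); these are exactly the thirteen 𝔽₃-rational points of ℙ² with the point (2:1:0) removed. Then: (i) each of the nine quadruples Γ₁ = {p,P₁,b,γ}, Γ₂ = {p,P₂,c,β}, Γ₃ = {p,P₃,a,α}, Γ₄ = {n,P₂,a,γ}, Γ₅ = {n,P₃,b,β}, Γ₆ = {n,P₁,c,α}, Γ₇ = {m,P₁,P₂,P₃},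 Γ₈ = {m,α,β,γ}, Γ₉ = {m,a,b,c} is collinear; (ii) a three-element subset of the twelve points is collinear (i.e., the corresponding vectors in 𝔽₃³ are linearly dependent) if and only if it is contained in one of Γ₁,…,Γ₉ or is one of the four triples {m,n,p}, {P₁,a,β}, {P₂,b,α}, {P₃,c,γ}. -/
/-!
STATEMENT 11: In `ℙ²(𝔽₃)`, the twelve listed points are exactly the thirteen rational points with
`(2:1:0)` removed; each of the nine quadruples `Γ₁,…,Γ₉` is collinear; and a three-element subset
of the twelve points is collinear iff it is contained in some `Γⱼ` or is one of the four triples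
`{m,n,p}, {P₁,a,β}, {P₂,b,α}, {P₃,c,γ}`.
Indices: m=0, n=1, p=2, a=3, b=4, c=5, P₁=6, P₂=7, P₃=8, α=9, β=10, γ=11.
-/

/-- The twelve points, as vectors in `(𝔽₃)³`. -/
def f3Pts : Fin 12 → (Fin 3 → ZMod 3) :=
  ![![1, 0, 0],  -- m
    ![1, 1, 0],  -- n
    ![0, 1, 0],  -- p
    ![1, 1, 1],  -- a
    ![0, 1, 1],  -- b
    ![2, 1, 1],  -- c
    ![0, 2, 1],  -- P₁
    ![2, 2, 1],  -- P₂
    ![1, 2, 1],  -- P₃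
    ![1, 0, 1],  -- α
    ![2, 0, 1],  -- β
    ![0, 0, 1]]  -- γ

/-- The nine quadruples (lines) of the configuration. -/
def f3Lines : Fin 9 → Finset (Fin 12) :=
  ![{2, 6, 4, 11}, {2, 7, 5, 10}, {2, 8, 3, 9},
    {1, 7, 3, 11}, {1, 8, 4, 10}, {1, 6, 5, 9},
    {0, 6, 7, 8}, {0, 9, 10, 11}, {0, 3, 4, 5}]

/-- The four extra collinear triples. -/
def f3ExtraTriples : Set (Finset (Fin 12)) :=
  {{0, 1, 2}, {6, 3, 10}, {7, 4, 9}, {8, 5, 11}}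

/-- Two nonzero vectors define the same projective point. -/
def projEqF3 {n : ℕ} (x y : Fin n → ZMod 3) : Prop :=
  ∃ c : ZMod 3, c ≠ 0 ∧ y = c • x

theorem finrank_span_eq_two_of_pair {K V : Type*} [Field K] [AddCommGroup V] [Module K V]
    {S : Set V} {v w : V} (hv : v ∈ S) (hw : w ∈ S)
    (hind : ∀ c d : K, c • v + d • w = 0 → c = 0 ∧ d = 0)
    (hS : ∀ x ∈ S, ∃ c d : K, c • v + d • w = x) :
    Module.finrank K (Submodule.span K S) = 2 := by
  have hspan : Submodule.span K S = Submodule.span K (Set.range ![v, w]) := by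
    rw [Matrix.range_cons_cons_empty]
    apply le_antisymm
    · exact Submodule.span_le.2 fun x hx => Submodule.mem_span_pair.2 (hS x hx)
    · exact Submodule.span_mono (Set.insert_subset hv (Set.singleton_subset_iff.2 hw))
  rw [hspan, finrank_span_eq_card (LinearIndependent.pair_iff.2 hind), Fintype.card_fin]

/-- Linear dependence of three vectors in `K³`, as the vanishing of their triple product. -/
theorem not_linearIndependent_three_iff {K : Type*} [Field K] (x y z : Fin 3 → K) :
    ¬ LinearIndependent K ![x, y, z] ↔
      x 0 * (y 1 * z 2 - y 2 * z 1) + x 1 * (y 2 * z 0 - y 0 * z 2) +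
        x 2 * (y 0 * z 1 - y 1 * z 0) = 0 := by
  have h := Matrix.linearIndependent_rows_iff_isUnit (A := Matrix.of ![x, y, z])
  rw [Matrix.isUnit_iff_isUnit_det, isUnit_iff_ne_zero] at h
  change LinearIndependent K ![x, y, z] ↔ _ at h
  rw [h, not_not, Matrix.det_fin_three]
  simp only [Matrix.of_apply, Matrix.cons_val]
  ring_nf

theorem f3Lines_pair (j : Fin 9) : ∃ s ∈ f3Lines j, ∃ t ∈ f3Lines j,
    (∀ c d : ZMod 3, c • f3Pts s + d • f3Pts t = 0 → c = 0 ∧ d = 0) ∧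
      ∀ u ∈ f3Lines j, ∃ c d : ZMod 3, c • f3Pts s + d • f3Pts t = f3Pts u := by
  revert j
  decide +kernel

theorem f3Pts_triple_product_eq_zero_iff : ∀ s t u : Fin 12, s ≠ t → s ≠ u → t ≠ u →
    (f3Pts s 0 * (f3Pts t 1 * f3Pts u 2 - f3Pts t 2 * f3Pts u 1) +
        f3Pts s 1 * (f3Pts t 2 * f3Pts u 0 - f3Pts t 0 * f3Pts u 2) +
          f3Pts s 2 * (f3Pts t 0 * f3Pts u 1 - f3Pts t 1 * f3Pts u 0) = 0 ↔
      (∃ j : Fin 9, ({s, t, u} : Finset (Fin 12)) ⊆ f3Lines j) ∨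
        ({s, t, u} : Finset (Fin 12)) ∈
          ({{0, 1, 2}, {6, 3, 10}, {7, 4, 9}, {8, 5, 11}} : Finset (Finset (Fin 12)))) := by
  decide +kernel

theorem f3_configuration :
    -- the twelve points are pairwise distinct in `ℙ²(𝔽₃)` …
    (∀ s t : Fin 12, s ≠ t → ¬ projEqF3 (f3Pts s) (f3Pts t)) ∧
    -- … none of them is the point (2:1:0) …
    (∀ t : Fin 12, ¬ projEqF3 (![2, 1, 0] : Fin 3 → ZMod 3) (f3Pts t)) ∧
    -- … and together with (2:1:0) they exhaust `ℙ²(𝔽₃)`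
    (∀ w : Fin 3 → ZMod 3, w ≠ 0 →
      (∃ t : Fin 12, projEqF3 (f3Pts t) w) ∨ projEqF3 (![2, 1, 0] : Fin 3 → ZMod 3) w) ∧
    -- (i) each `Γⱼ` is collinear
    (∀ j : Fin 9,
      Module.finrank (ZMod 3) ↥(Submodule.span (ZMod 3) (f3Pts '' ↑(f3Lines j))) = 2) ∧
    -- (ii) a triple of distinct points is collinear iff it lies in some `Γⱼ`
    -- or is one of the four extra triples
    (∀ s t u : Fin 12, s ≠ t → s ≠ u → t ≠ u →
      (¬ LinearIndependent (ZMod 3) ![f3Pts s, f3Pts t, f3Pts u] ↔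
        (∃ j : Fin 9, ({s, t, u} : Finset (Fin 12)) ⊆ f3Lines j) ∨
          ({s, t, u} : Finset (Fin 12)) ∈ f3ExtraTriples)) := by
  refine ⟨?_, ?_, ?_, fun j => ?_, fun s t u hst hsu htu => ?_⟩
  · unfold projEqF3
    decide +kernel
  · unfold projEqF3
    decide +kernel
  · unfold projEqF3
    decide +kernel
  · obtain ⟨s, hs, t, ht, hind, hspan⟩ := f3Lines_pair j
    refine finrank_span_eq_two_of_pair (Set.mem_image_of_mem f3Pts hs)
      (Set.mem_image_of_mem f3Pts ht) hind ?_
    rintro _ ⟨u, hu, rfl⟩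
    exact hspan u hu
  · rw [not_linearIndependent_three_iff, f3Pts_triple_product_eq_zero_iff s t u hst hsu htu]
    simp [f3ExtraTriples]
end

section
/- Let ω ∈ ℂ be a primitive cube root of unity. Consider the 13×9 complex matrix with rows r₁ = (0, 0, 0, 1, 0, ω+1, −ω−1, 0, ω+1), r₂ = (−1, 0, ω, ω, 0, −ω−3, 2ω+3, 0, −ω−1), r₃ = (−ω+1, 0, 0, 0, 0, −ω+1, −ω−2, 0, 0), r₄ = (0, 0, 0, 1, −ω−1, ω, −ω−1, 1, ω), r₅ = (0, 0, 0, 2ω−1, 3ω+4, −5ω−3, 3ω+5, 3ω−1, −3ω−1), r₆ = (0, 0, 0, −5ω−1, −3ω−9, 8ω+10, −2ω−10, −9ω−3, 5ω+4), r₇ = (0, 0, 0, 3ω+3, 9, −3ω−12, −3ω+9, 9ω+9, −3ω−3), r₈ = (0, 0, 0, 0, 3ω−3, −3ω+3, 3ω−3, −3ω−6, 0), r₉ = (0, 0, 0, −2ω, 0, 2, 0, −2ω−2, 2ω+2), r₁₀ = (−2, 4ω+4, 0, 6ω+7, 0, 9ω−1, 0, −ω+8, −ω−6), r₁₁ = (−7ω+1,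 −12, 0, ω−7, 0, −20ω−16, 0, 15ω, −4ω+4), r₁₂ = (12ω+9, 3−12ω, 0, −3ω, 0, 6ω+18, 0, −15ω−12, 3ω), r₁₃ = (−3ω−6, 6ω+3, 0, 0, 0, 3ω−3, 0, 3ω+6, 0). Then this matrix has rank 9; in fact the nine rows r₁, r₂, r₃, r₆, r₇, r₈, r₁₁, r₁₂, r₁₃ are linearly independent. Moreover, the three 2×2 complex matrices [[−18ω−18, −30ω−12], [−30ω−12, −12ω+54]], [[4ω+8, 16ω+8], [16ω+8, 16ω−16]], [[−126ω+42, 42ω+84], [42ω+84, 42ω+42]] are linearly independent over ℂ. -/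
/-!
STATEMENT 12: For a primitive cube root of unity `ω ∈ ℂ`, the 13×9 Jacobian matrix of the dual
Hesse hypergraph equations has rank 9 (with rows 1,2,3,6,7,8,11,12,13 linearly independent), and
the three 2×2 Hessian matrices are linearly independent over ℂ.
-/

/-- The 13×9 Jacobian matrix `[∂fᵢ/∂wⱼ]` at the dual Hesse point. -/
noncomputable def hesseJacobian (ω : ℂ) : Matrix (Fin 13) (Fin 9) ℂ :=
  !![0, 0, 0, 1, 0, ω + 1, -ω - 1, 0, ω + 1;
     -1, 0, ω, ω, 0, -ω - 3, 2 * ω + 3, 0, -ω - 1;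
     -ω + 1, 0, 0, 0, 0, -ω + 1, -ω - 2, 0, 0;
     0, 0, 0, 1, -ω - 1, ω, -ω - 1, 1, ω;
     0, 0, 0, 2 * ω - 1, 3 * ω + 4, -5 * ω - 3, 3 * ω + 5, 3 * ω - 1, -3 * ω - 1;
     0, 0, 0, -5 * ω - 1, -3 * ω - 9, 8 * ω + 10, -2 * ω - 10, -9 * ω - 3, 5 * ω + 4;
     0, 0, 0, 3 * ω + 3, 9, -3 * ω - 12, -3 * ω + 9, 9 * ω + 9, -3 * ω - 3;
     0, 0, 0, 0, 3 * ω - 3, -3 * ω + 3, 3 * ω - 3, -3 * ω - 6, 0;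
     0, 0, 0, -2 * ω, 0, 2, 0, -2 * ω - 2, 2 * ω + 2;
     -2, 4 * ω + 4, 0, 6 * ω + 7, 0, 9 * ω - 1, 0, -ω + 8, -ω - 6;
     -7 * ω + 1, -12, 0, ω - 7, 0, -20 * ω - 16, 0, 15 * ω, -4 * ω + 4;
     12 * ω + 9, 3 - 12 * ω, 0, -3 * ω, 0, 6 * ω + 18, 0, -15 * ω - 12, 3 * ω;
     -3 * ω - 6, 6 * ω + 3, 0, 0, 0, 3 * ω - 3, 0, 3 * ω + 6, 0]

/-- The three 2×2 Hessian matrices. -/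
noncomputable def hesseHessians (ω : ℂ) : Fin 3 → Matrix (Fin 2) (Fin 2) ℂ :=
  ![!![-18 * ω - 18, -30 * ω - 12; -30 * ω - 12, -12 * ω + 54],
    !![4 * ω + 8, 16 * ω + 8; 16 * ω + 8, 16 * ω - 16],
    !![-126 * ω + 42, 42 * ω + 84; 42 * ω + 84, 42 * ω + 42]]

lemma IsPrimitiveRoot.sq_add_self_add_one {R : Type*} [CommRing R] [IsDomain R] {ω : R}
    (hω : IsPrimitiveRoot ω 3) : ω ^ 2 + ω + 1 = 0 := by
  have h := hω.geom_sum_eq_zero (by norm_num)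
  simp only [Finset.sum_range_succ, Finset.sum_range_zero] at h
  linear_combination h

/-- A matrix with a linearly independent family of rows has rank at least the size of the family. -/
lemma Matrix.card_le_rank_of_linearIndependent_rows {K m n ι : Type*} [Field K] [Fintype n]
    [Finite m] [Fintype ι] {A : Matrix m n K} {f : ι → m}
    (h : LinearIndependent K (fun i ↦ A (f i))) : Fintype.card ι ≤ A.rank := by
  rw [A.rank_eq_finrank_span_row, ← finrank_span_eq_card h]
  exact Submodule.finrank_mono (Submodule.span_mono (Set.range_comp_subset_range f A))

lemma hesseJacobian_linearIndependent_rows {ω : ℂ} (h : ω ^ 2 + ω + 1 = 0) :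
    LinearIndependent ℂ
      (fun i : Fin 9 => hesseJacobian ω (![0, 1, 2, 5, 6, 7, 10, 11, 12] i)) := by
  rw [Fintype.linearIndependent_iff]
  intro c hc
  have h0 := congrFun hc 0
  have h1 := congrFun hc 1
  have h2 := congrFun hc 2
  have h3 := congrFun hc 3
  have h4 := congrFun hc 4
  have h5 := congrFun hc 5
  have h6 := congrFun hc 6
  have h7 := congrFun hc 7
  have h8 := congrFun hc 8
  simp [hesseJacobian, Fin.sum_univ_succ, -mul_eq_zero] at h0 h1 h2 h3 h4 h5 h6 h7 h8
  have e0 : c 0 = 0 := by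
    linear_combination (-1 + ω) / 6 * h0 + (1 + 2 * ω) / 6 * h1 + (-2 - ω) / 2 * h2
      + (-ω) / 2 * h3 + (1 - ω) / 6 * h4 + (-1 - 2 * ω) / 6 * h5 + (-1 + ω) / 6 * h6
      + (-2 - ω) / 6 * h7 + 1 / 2 * h8
      - (-1 / 2 * c 0 - 1 / 3 * c 1 + 3 / 2 * c 3 - 5 / 2 * c 4 + 3 / 2 * c 5 + 5 / 2 * c 6) * h
  have e1 : c 1 = 0 := by
    linear_combination (-1 - ω) * h2 - (-c 1) * h
  have e2 : c 2 = 0 := by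
    linear_combination (2 + ω) / 6 * h0 + (1 - ω) / 6 * h1 + (-1 - 2 * ω) / 2 * h2 + (-1) / 6 * h3
      + (-ω) / 6 * h4 + (1 + ω) / 6 * h5 + ω / 6 * h6 + 1 / 6 * h7 + (-1 - ω) / 6 * h8
      - (-1 / 6 * c 0 - 2 / 3 * c 1 - 1 / 2 * c 2 + 2 / 3 * c 3 - 1 / 2 * c 4
        - 1 / 2 * c 5 - 23 / 6 * c 6 + 9 / 2 * c 7 - c 8) * h
  have e3 : c 3 = 0 := by
    linear_combination (2 + ω) / 18 * h0 + (1 + ω) / 6 * h1 + (1 + 2 * ω) / 18 * h2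
      + (1 + 2 * ω) / 18 * h3 + (-2 - ω) / 6 * h4 + (-1 + ω) / 18 * h5 + (2 + ω) / 18 * h6
      + 1 / 6 * h7 + (1 - ω) / 18 * h8
      - (-1 / 18 * c 0 + 1 / 3 * c 1 - 1 / 6 * c 2 + 1 / 6 * c 4 - 1 / 2 * c 5
        - 7 / 6 * c 6 - 3 / 2 * c 7 + c 8) * h
  have e4 : c 4 = 0 := by
    linear_combination ω / 9 * h0 + (1 + 2 * ω) / 9 * h1 + 2 * ω / 9 * h2 + (1 + ω) / 9 * h3
      + (-1 - ω) / 3 * h4 + ω / 9 * h5 + (2 + 2 * ω) / 9 * h6 + (2 + ω) / 9 * h7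
      + (1 + ω) / 9 * h8
      - (5 / 9 * c 1 - 4 / 9 * c 2 + 4 / 9 * c 3 - c 5 - 5 / 3 * c 6 - 7 / 3 * c 7
        + 5 / 3 * c 8) * h
  have e5 : c 5 = 0 := by
    linear_combination (-4 - ω) / 18 * h0 + (-1 + ω) / 18 * h1 + (-3 + 2 * ω) / 18 * h2
      + (3 + 2 * ω) / 18 * h3 + (-4 - 5 * ω) / 18 * h4 + (1 + 3 * ω) / 18 * h5
      + (2 + 5 * ω) / 18 * h6 + (1 + 2 * ω) / 18 * h7 + (-1 + 3 * ω) / 18 * h8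
      - (1 / 18 * c 0 + 4 / 9 * c 1 - 7 / 18 * c 2 + 8 / 9 * c 3 - 1 / 2 * c 4
        - 5 / 6 * c 5 - 11 / 6 * c 6 - 11 / 6 * c 7 + 4 / 3 * c 8) * h
  have e6 : c 6 = 0 := by
    linear_combination (1 + 2 * ω) / 18 * h0 + (2 + ω) / 6 * h1 + (-1 + ω) / 18 * h2
      + (-1 + ω) / 18 * h3 + (-1) / 6 * h4 + (-2 - ω) / 18 * h5 + (1 + 2 * ω) / 18 * h6
      + (-1 - ω) / 6 * h7 + (2 + ω) / 18 * h8
      - (-1 / 9 * c 0 + 1 / 3 * c 1 - 1 / 6 * c 2 + 5 / 6 * c 3 - 5 / 3 * c 4 + c 5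
        - 7 / 3 * c 6 + 3 / 2 * c 7) * h
  have e7 : c 7 = 0 := by
    linear_combination (-1 + 5 * ω) / 18 * h0 + (3 + 4 * ω) / 6 * h1 + (-6 - ω) / 18 * h2
      + (-2 + ω) / 18 * h3 + (-7 - 5 * ω) / 18 * h4 + (-1 - 4 * ω) / 18 * h5
      + (1 + 3 * ω) / 18 * h6 + (-2 - 7 * ω) / 18 * h7 + (1 + 4 * ω) / 18 * h8
      - (-1 / 6 * c 0 + 1 / 3 * c 1 - 2 / 9 * c 2 + 55 / 18 * c 3 - 23 / 6 * c 4
        + 3 / 2 * c 5 - 25 / 6 * c 6 + 1 / 3 * c 7 + 4 / 3 * c 8) * h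
  have e8 : c 8 = 0 := by
    linear_combination (-3 + ω) / 6 * h0 + (1 + 14 * ω) / 18 * h1 + (-4 - 3 * ω) / 6 * h2
      + (-4 + ω) / 18 * h3 + (-7 - 11 * ω) / 18 * h4 + (5 - 2 * ω) / 18 * h5
      + (1 + 5 * ω) / 18 * h6 + (4 - 7 * ω) / 18 * h7 + (-5 + 2 * ω) / 18 * h8
      - (-5 / 18 * c 0 + 1 / 9 * c 1 - 1 / 3 * c 2 + 25 / 6 * c 3 - 25 / 6 * c 4
        + 1 / 2 * c 5 - 31 / 6 * c 6 - 2 * c 7 + 8 / 3 * c 8) * h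
  intro i
  fin_cases i <;> assumption

lemma hesseHessians_linearIndependent {ω : ℂ} (h : ω ^ 2 + ω + 1 = 0) :
    LinearIndependent ℂ (hesseHessians ω) := by
  rw [Fintype.linearIndependent_iff]
  intro c hc
  have h0 := congrFun (congrFun hc 0) 0
  have h1 := congrFun (congrFun hc 0) 1
  have h2 := congrFun (congrFun hc 1) 1
  simp [hesseHessians, Fin.sum_univ_succ, -mul_eq_zero] at h0 h1 h2
  have e0 : c 0 = 0 := by
    linear_combination (1 + 3 * ω) / 63 * h0 + (-15 - 4 * ω) / 126 * h1 + (1 - 5 * ω) / 126 * h2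
      - (4 / 7 * c 0 - 20 / 21 * c 1 - 9 * c 2) * h
  have e1 : c 1 = 0 := by
    linear_combination (-1 + 25 * ω) / 252 * h0 + (-67 - 38 * ω) / 252 * h1
      + (1 - 10 * ω) / 126 * h2 - (155 / 42 * c 0 - 23 / 7 * c 1 - 133 / 6 * c 2) * h
  have e2 : c 2 = 0 := by
    linear_combination (3 + 2 * ω) / 441 * h0 + (2 - ω) / 882 * h1 + (1 + 3 * ω) / 882 * h2
      - (-13 / 147 * c 0 + 8 / 147 * c 1 - 10 / 21 * c 2) * h
  intro i
  fin_cases i <;> assumption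

theorem hesse_jacobian_rank (ω : ℂ) (hω : IsPrimitiveRoot ω 3) :
    (hesseJacobian ω).rank = 9 ∧
    LinearIndependent ℂ
      (fun i : Fin 9 => hesseJacobian ω (![0, 1, 2, 5, 6, 7, 10, 11, 12] i)) ∧
    LinearIndependent ℂ (hesseHessians ω) := by
  have h := hω.sq_add_self_add_one
  have hrows := hesseJacobian_linearIndependent_rows h
  refine ⟨le_antisymm ?_ ?_, hrows, hesseHessians_linearIndependent h⟩
  · simpa using (hesseJacobian ω).rank_le_width
  · simpa using Matrix.card_le_rank_of_linearIndependent_rows hrows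
end

section
/- Let k be a field. Consider twelve pairwise distinct points of ℙ¹(k) = k ∪ {∞}, labeled m', n', p', 1', 2', 3', a', b', c', α', β', γ', normalized so that 1' = ∞, m' = 0, and a' = 1. Then the triple of values (b', p', n') together with the nine cross-ratios w₁ = [p',1',b',γ'], w₂ = [p',2',c',β'], w₃ = [p',3',a',α'], w₄ = [n',γ',a',2'], w₅ = [n',β',b',3'], w₆ = [n',α',c',1'], w₇ = [m',1',2',3'], w₈ = [m',γ',β',α'], w₉ = [m',b',c',a'] determine the twelve points uniquely: if two such normalized twelve-tuples of pairwise distinct points of ℙ¹(k) have the same values of b', p', n' and of w₁, …, w₉, then they also have the same values of 2', 3', c', α', β', γ', hence are equal. -/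
/-!
STATEMENT 13: Twelve pairwise distinct points of `ℙ¹(k) = k ∪ {∞}`, labeled
`m', n', p', 1', 2', 3', a', b', c', α', β', γ'` and normalized by `1' = ∞`, `m' = 0`, `a' = 1`,
are uniquely determined by the values `b', p', n'` together with the nine cross-ratios
`w₁ = [p',1',b',γ']`, `w₂ = [p',2',c',β']`, `w₃ = [p',3',a',α']`, `w₄ = [n',γ',a',2']`,
`w₅ = [n',β',b',3']`, `w₆ = [n',α',c',1']`, `w₇ = [m',1',2',3']`, `w₈ = [m',γ',β',α']`,
`w₉ = [m',b',c',a']`.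
Here `[x,y,z,s] = ((s−x)(y−z))/((y−x)(s−z))` for finite entries, with the conventions
`[x,∞,z,s] = (s−x)/(s−z)` and `[x,y,z,∞] = (y−z)/(y−x)`.
-/

/-- The cross-ratio `[x,y,z,s]` of four finite points. -/
def cr {k : Type*} [Field k] (x y z s : k) : k :=
  ((s - x) * (y - z)) / ((y - x) * (s - z))

/-- The cross-ratio `[x,∞,z,s]`. -/
def crInfSnd {k : Type*} [Field k] (x z s : k) : k :=
  (s - x) / (s - z)

/-- The cross-ratio `[x,y,z,∞]`. -/
def crInfFour {k : Type*} [Field k] (x y z : k) : k :=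
  (y - z) / (y - x)

theorem crInfSnd_right_injOn {k : Type*} [Field k] {x z s s' : k} (hxz : x ≠ z)
    (hs : s ≠ z) (hs' : s' ≠ z) (h : crInfSnd x z s = crInfSnd x z s') : s = s' := by
  unfold crInfSnd at h
  rw [div_eq_div_iff (sub_ne_zero.2 hs) (sub_ne_zero.2 hs')] at h
  refine mul_left_cancel₀ (sub_ne_zero.2 hxz) ?_
  linear_combination h

theorem crInfFour_middle_injOn {k : Type*} [Field k] {x y y' z : k} (hxz : x ≠ z)
    (hy : y ≠ x) (hy' : y' ≠ x) (h : crInfFour x y z = crInfFour x y' z) : y = y' := by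
  unfold crInfFour at h
  rw [div_eq_div_iff (sub_ne_zero.2 hy) (sub_ne_zero.2 hy')] at h
  refine mul_left_cancel₀ (sub_ne_zero.2 hxz) ?_
  linear_combination -h

theorem cr_eq_mul {k : Type*} [Field k] (x y z s : k) :
    cr x y z s = crInfSnd x z s * crInfFour x y z := by
  rw [cr, crInfSnd, crInfFour, div_mul_div_comm, mul_comm (y - x)]

theorem cr_fourth_injOn {k : Type*} [Field k] {x y z s s' : k} (hxz : x ≠ z) (hyx : y ≠ x)
    (hyz : y ≠ z) (hs : s ≠ z) (hs' : s' ≠ z) (h : cr x y z s = cr x y z s') : s = s' := by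
  rw [cr_eq_mul, cr_eq_mul] at h
  exact crInfSnd_right_injOn hxz hs hs'
    (mul_right_cancel₀ (div_ne_zero (sub_ne_zero.2 hyz) (sub_ne_zero.2 hyx)) h)

theorem cr_second_injOn {k : Type*} [Field k] {x y y' z s : k} (hxz : x ≠ z) (hsx : s ≠ x)
    (hsz : s ≠ z) (hy : y ≠ x) (hy' : y' ≠ x) (h : cr x y z s = cr x y' z s) : y = y' := by
  rw [cr_eq_mul, cr_eq_mul] at h
  exact crInfFour_middle_injOn hxz hy hy'
    (mul_left_cancel₀ (div_ne_zero (sub_ne_zero.2 hsx) (sub_ne_zero.2 hsz)) h)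

theorem cr_third_injOn {k : Type*} [Field k] {x y z z' s : k} (hyx : y ≠ x) (hsx : s ≠ x)
    (hys : y ≠ s) (hz : s ≠ z) (hz' : s ≠ z') (h : cr x y z s = cr x y z' s) : z = z' := by
  unfold cr at h
  have hyx := sub_ne_zero.2 hyx
  have hsx := sub_ne_zero.2 hsx
  rw [div_eq_div_iff (mul_ne_zero hyx (sub_ne_zero.2 hz))
    (mul_ne_zero hyx (sub_ne_zero.2 hz'))] at h
  refine mul_left_cancel₀ (mul_ne_zero (mul_ne_zero hsx hyx) (sub_ne_zero.2 hys)) ?_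
  linear_combination h

theorem cross_ratios_determine_twelve_points (k : Type*) [Field k]
    -- first tuple: `1' = ∞`, `m' = 0`, `a' = 1`, and the remaining nine finite points
    (p n b t2 t3 c al be ga : k)
    -- second tuple
    (p' n' b' t2' t3' c' al' be' ga' : k)
    -- the twelve points of each tuple are pairwise distinct
    -- (i.e. `∞` together with the eleven pairwise distinct finite values below)
    (hdist : Function.Injective (![0, 1, p, n, b, t2, t3, c, al, be, ga] : Fin 11 → k))
    (hdist' : Function.Injective (![0, 1, p', n', b', t2', t3', c', al', be', ga'] : Fin 11 → k))
    -- same values of `b'`, `p'`, `n'`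
    (hb : b = b') (hp : p = p') (hn : n = n')
    -- same nine cross-ratios
    (hw1 : crInfSnd p b ga = crInfSnd p' b' ga')
    (hw2 : cr p t2 c be = cr p' t2' c' be')
    (hw3 : cr p t3 1 al = cr p' t3' 1 al')
    (hw4 : cr n ga 1 t2 = cr n' ga' 1 t2')
    (hw5 : cr n be b t3 = cr n' be' b' t3')
    (hw6 : crInfFour n al c = crInfFour n' al' c')
    (hw7 : crInfSnd 0 t2 t3 = crInfSnd 0 t2' t3')
    (hw8 : cr 0 ga be al = cr 0 ga' be' al')
    (hw9 : cr 0 b c 1 = cr 0 b' c' 1) :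
    -- then the remaining six points agree as well
    t2 = t2' ∧ t3 = t3' ∧ c = c' ∧ al = al' ∧ be = be' ∧ ga = ga' := by
  have hp_b : p ≠ b := hdist.ne (a₁ := 2) (a₂ := 4) (by decide)
  have hga_b : ga ≠ b := hdist.ne (a₁ := 10) (a₂ := 4) (by decide)
  have hga_b' : ga' ≠ b' := hdist'.ne (a₁ := 10) (a₂ := 4) (by decide)
  have hb_0 : b ≠ (0 : k) := hdist.ne (a₁ := 4) (a₂ := 0) (by decide)
  have h1_0 : 1 ≠ (0 : k) := hdist.ne (a₁ := 1) (a₂ := 0) (by decide)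
  have hb_1 : b ≠ 1 := hdist.ne (a₁ := 4) (a₂ := 1) (by decide)
  have h1_c : 1 ≠ c := hdist.ne (a₁ := 1) (a₂ := 7) (by decide)
  have h1_c' : 1 ≠ c' := hdist'.ne (a₁ := 1) (a₂ := 7) (by decide)
  have hn_1 : n ≠ 1 := hdist.ne (a₁ := 3) (a₂ := 1) (by decide)
  have hga_n : ga ≠ n := hdist.ne (a₁ := 10) (a₂ := 3) (by decide)
  have hga_1 : ga ≠ 1 := hdist.ne (a₁ := 10) (a₂ := 1) (by decide)
  have ht2_1 : t2 ≠ 1 := hdist.ne (a₁ := 5) (a₂ := 1) (by decide)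
  have ht2_1' : t2' ≠ 1 := hdist'.ne (a₁ := 5) (a₂ := 1) (by decide)
  have hn_c : n ≠ c := hdist.ne (a₁ := 3) (a₂ := 7) (by decide)
  have hal_n : al ≠ n := hdist.ne (a₁ := 8) (a₂ := 3) (by decide)
  have hal_n' : al' ≠ n' := hdist'.ne (a₁ := 8) (a₂ := 3) (by decide)
  have h0_t2 : (0 : k) ≠ t2 := hdist.ne (a₁ := 0) (a₂ := 5) (by decide)
  have ht3_t2 : t3 ≠ t2 := hdist.ne (a₁ := 6) (a₂ := 5) (by decide)
  have ht3_t2' : t3' ≠ t2' := hdist'.ne (a₁ := 6) (a₂ := 5) (by decide)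
  have hn_b : n ≠ b := hdist.ne (a₁ := 3) (a₂ := 4) (by decide)
  have ht3_n : t3 ≠ n := hdist.ne (a₁ := 6) (a₂ := 3) (by decide)
  have ht3_b : t3 ≠ b := hdist.ne (a₁ := 6) (a₂ := 4) (by decide)
  have hbe_n : be ≠ n := hdist.ne (a₁ := 9) (a₂ := 3) (by decide)
  have hbe_n' : be' ≠ n' := hdist'.ne (a₁ := 9) (a₂ := 3) (by decide)
  clear hdist hdist'
  subst hb hp hn
  have hga : ga = ga' := crInfSnd_right_injOn hp_b hga_b hga_b' hw1
  have hc : c = c' := cr_third_injOn hb_0 h1_0 hb_1 h1_c h1_c' hw9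
  subst hga hc
  have ht2 : t2 = t2' := cr_fourth_injOn hn_1 hga_n hga_1 ht2_1 ht2_1' hw4
  have hal : al = al' := crInfFour_middle_injOn hn_c hal_n hal_n' hw6
  subst ht2 hal
  have ht3 : t3 = t3' := crInfSnd_right_injOn h0_t2 ht3_t2 ht3_t2' hw7
  subst ht3
  have hbe : be = be' := cr_second_injOn hn_b ht3_n ht3_b hbe_n hbe_n' hw5
  exact ⟨rfl, rfl, rfl, rfl, hbe, rfl⟩
end

section
/- Let k be an algebraically closed field and let p₁, …, pₙ be distinct points of ℙ²(k) such that no plane conic — i.e., the zero locus of a nonzero homogeneous quadratic form in three variables, possibly degenerate — contains all of them. Then there exist four of the points p₁, …, pₙ that lie on a smooth conic, i.e., on the zero locus of a homogeneous quadratic form whose projective zero locus has no singular point. -/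
/-!
STATEMENT 14: Over an algebraically closed field `k`, if `p₁, …, pₙ` are distinct points of
`ℙ²(k)` such that no plane conic (the zero locus of a nonzero homogeneous quadratic form, possibly
degenerate) contains all of them, then four of the points lie on a smooth conic (the zero locus of
a homogeneous quadratic form whose projective zero locus contains no common zero of all three
partial derivatives).
-/

open MvPolynomial

/-- The linear form on `k³` with coefficient vector `u`. -/
noncomputable def linearForm {k : Type*} [Field k] (u : Fin 3 → k) : MvPolynomial (Fin 3) k :=
  ∑ j, C (u j) * X j

section

open Matrix

variable {k : Type*} [Field k]

theorem eval_linearForm (u w : Fin 3 → k) : eval w (linearForm u) = u ⬝ᵥ w := by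
  simp [linearForm, dotProduct]

theorem pderiv_linearForm (u : Fin 3 → k) (j : Fin 3) : pderiv j (linearForm u) = C (u j) := by
  simp [linearForm, Derivation.leibniz, pderiv_X, Pi.single_apply]

theorem isHomogeneous_linearForm (u : Fin 3 → k) : (linearForm u).IsHomogeneous 1 :=
  IsHomogeneous.sum _ _ _ fun _ _ => by
    simpa using (isHomogeneous_C (Fin 3) _).mul (isHomogeneous_X k _)

theorem linearForm_ne_zero {u : Fin 3 → k} (hu : u ≠ 0) : linearForm u ≠ 0 := by
  intro h
  refine hu (funext fun j => C_injective (Fin 3) k ?_)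
  simp [← pderiv_linearForm, h]

theorem isHomogeneous_linearForm_mul (u v : Fin 3 → k) :
    (linearForm u * linearForm v).IsHomogeneous 2 :=
  (isHomogeneous_linearForm u).mul (isHomogeneous_linearForm v)

/-- Expansion of a vector of `k³` in three given vectors (Cramer's rule). -/
theorem tripleProduct_smul_eq (a b c w : Fin 3 → k) :
    ((a ⨯₃ b) ⬝ᵥ c) • w =
      ((b ⨯₃ c) ⬝ᵥ w) • a + ((c ⨯₃ a) ⬝ᵥ w) • b + ((a ⨯₃ b) ⬝ᵥ w) • c := by
  ext j
  fin_cases j <;> simp [cross_apply, dotProduct, Fin.sum_univ_three] <;> ring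

theorem tripleProduct_mul_swap (a b c d e : Fin 3 → k) :
    ((b ⨯₃ d) ⬝ᵥ e) * ((a ⨯₃ b) ⬝ᵥ c) =
      ((a ⨯₃ b) ⬝ᵥ d) * ((b ⨯₃ c) ⬝ᵥ e) - ((a ⨯₃ b) ⬝ᵥ e) * ((b ⨯₃ c) ⬝ᵥ d) := by
  simp only [cross_apply, vec3_dotProduct, cons_val_zero, cons_val_one, cons_val]
  ring

/-- The cyclic invariance of the triple product. -/
theorem tripleProduct_rotate (a b c : Fin 3 → k) : (b ⨯₃ c) ⬝ᵥ a = (a ⨯₃ b) ⬝ᵥ c := by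
  simp only [cross_apply, vec3_dotProduct, cons_val_zero, cons_val_one, cons_val]
  ring

theorem tripleProduct_swap (a b c : Fin 3 → k) : (b ⨯₃ a) ⬝ᵥ c = -((a ⨯₃ b) ⬝ᵥ c) := by
  rw [← cross_anticomm, neg_dotProduct]

/-- A conic through the coordinate points with nonzero coefficients is smooth. -/
theorem eq_zero_of_conic_singular {l m n x y z : k} (hl : l ≠ 0) (hm : m ≠ 0) (hn : n ≠ 0)
    (hq : l * (y * z) + m * (z * x) + n * (x * y) = 0)
    (hx : m * z + n * y = 0) (hy : l * z + n * x = 0) :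
    x = 0 ∧ y = 0 ∧ z = 0 := by
  have hz0 : z = 0 := by
    have : l * m * n * z ^ 2 = 0 := by
      linear_combination (-n ^ 2) * hq + (n * l * z + n ^ 2 * x) * hx
    simpa [hl, hm, hn] using this
  subst hz0
  simp_all

/-- Four vectors of `k³` no three of which are dependent lie on a smooth conic. -/
theorem exists_smooth_conic [Infinite k] {a b c d : Fin 3 → k}
    (habc : (a ⨯₃ b) ⬝ᵥ c ≠ 0) (habd : (a ⨯₃ b) ⬝ᵥ d ≠ 0)
    (hbcd : (b ⨯₃ c) ⬝ᵥ d ≠ 0) (hcad : (c ⨯₃ a) ⬝ᵥ d ≠ 0) :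
    ∃ q : MvPolynomial (Fin 3) k, q ≠ 0 ∧ q.IsHomogeneous 2 ∧
      eval a q = 0 ∧ eval b q = 0 ∧ eval c q = 0 ∧ eval d q = 0 ∧
      (∀ w : Fin 3 → k, w ≠ 0 → eval w q = 0 → ∃ j : Fin 3, eval w (pderiv j q) ≠ 0) := by
  classical
  obtain ⟨t, ht⟩ := Infinite.exists_notMem_finset ({0, -1} : Finset k)
  simp only [Finset.mem_insert, Finset.mem_singleton, not_or] at ht
  obtain ⟨l, hl⟩ : ∃ l, l = (b ⨯₃ c) ⬝ᵥ d := ⟨_, rfl⟩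
  obtain ⟨m, hm⟩ : ∃ m, m = t * ((c ⨯₃ a) ⬝ᵥ d) := ⟨_, rfl⟩
  obtain ⟨n, hn⟩ : ∃ n, n = -(1 + t) * ((a ⨯₃ b) ⬝ᵥ d) := ⟨_, rfl⟩
  have hl0 : l ≠ 0 := hl ▸ hbcd
  have hm0 : m ≠ 0 := hm ▸ mul_ne_zero ht.1 hcad
  have hn0 : n ≠ 0 := hn ▸ mul_ne_zero
    (neg_ne_zero.2 fun h => ht.2 (by linear_combination h)) habd
  obtain ⟨q, hq⟩ : ∃ q, q =
      C l * (linearForm (c ⨯₃ a) * linearForm (a ⨯₃ b)) +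
      C m * (linearForm (a ⨯₃ b) * linearForm (b ⨯₃ c)) +
      C n * (linearForm (b ⨯₃ c) * linearForm (c ⨯₃ a)) := ⟨_, rfl⟩
  have heval (w : Fin 3 → k) : eval w q =
      l * (((c ⨯₃ a) ⬝ᵥ w) * ((a ⨯₃ b) ⬝ᵥ w)) + m * (((a ⨯₃ b) ⬝ᵥ w) * ((b ⨯₃ c) ⬝ᵥ w)) +
      n * (((b ⨯₃ c) ⬝ᵥ w) * ((c ⨯₃ a) ⬝ᵥ w)) := by
    simp [hq, eval_linearForm]
  have hsmooth : ∀ w : Fin 3 → k, w ≠ 0 → eval w q = 0 →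
      ∃ j : Fin 3, eval w (pderiv j q) ≠ 0 := by
    intro w hw hqw
    by_contra! h
    have hgrad (v : Fin 3 → k) :
        (m * ((a ⨯₃ b) ⬝ᵥ w) + n * ((c ⨯₃ a) ⬝ᵥ w)) * ((b ⨯₃ c) ⬝ᵥ v) +
        (l * ((a ⨯₃ b) ⬝ᵥ w) + n * ((b ⨯₃ c) ⬝ᵥ w)) * ((c ⨯₃ a) ⬝ᵥ v) +
        (l * ((c ⨯₃ a) ⬝ᵥ w) + m * ((b ⨯₃ c) ⬝ᵥ w)) * ((a ⨯₃ b) ⬝ᵥ v) = 0 := by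
      have h' (j : Fin 3) := h j
      simp only [hq, map_add, Derivation.leibniz, pderiv_linearForm, pderiv_C, eval_linearForm,
        smul_eq_mul, map_mul, eval_C, mul_zero, add_zero] at h'
      rw [vec3_dotProduct _ v, vec3_dotProduct _ v, vec3_dotProduct _ v]
      linear_combination v 0 * h' 0 + v 1 * h' 1 + v 2 * h' 2
    have ha := hgrad a
    have hb := hgrad b
    have hbca : (b ⨯₃ c) ⬝ᵥ a ≠ 0 := by rwa [tripleProduct_rotate]
    have hcab : (c ⨯₃ a) ⬝ᵥ b ≠ 0 := by rwa [tripleProduct_rotate, tripleProduct_rotate]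
    simp only [dotProduct_comm _ a, dotProduct_comm _ b, dot_self_cross, dot_cross_self,
      mul_zero, add_zero, zero_add] at ha hb
    rw [dotProduct_comm] at hbca hcab
    obtain ⟨hx, hy, hz⟩ := eq_zero_of_conic_singular hl0 hm0 hn0 ((heval w).symm.trans hqw)
      ((mul_eq_zero.1 ha).resolve_right hbca) ((mul_eq_zero.1 hb).resolve_right hcab)
    have := tripleProduct_smul_eq a b c w
    rw [hx, hy, hz] at this
    simp [habc, hw] at this
  refine ⟨q, ?_, ?_, ?_, ?_, ?_, ?_, hsmooth⟩
  · rintro rfl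
    simpa using hsmooth 1 one_ne_zero
  · rw [hq]
    refine ((?_ : IsHomogeneous _ 2).add ?_).add ?_ <;>
      exact (isHomogeneous_linearForm_mul _ _).C_mul _
  · rw [heval, dotProduct_comm _ a, dotProduct_comm _ a, dotProduct_comm _ a]
    simp [dot_self_cross, dot_cross_self]
  · rw [heval, dotProduct_comm _ b, dotProduct_comm _ b, dotProduct_comm _ b]
    simp [dot_self_cross, dot_cross_self]
  · rw [heval, dotProduct_comm _ c, dotProduct_comm _ c, dotProduct_comm _ c]
    simp [dot_self_cross, dot_cross_self]
  · rw [heval, hl, hm, hn]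
    ring

/-- A family of vectors of `k³` not contained in a plane has three independent members. -/
theorem exists_tripleProduct_ne_zero {ι : Type*} {v : ι → Fin 3 → k}
    (hv : ∀ u : Fin 3 → k, u ≠ 0 → ∃ i, u ⬝ᵥ v i ≠ 0) :
    ∃ i j l, (v i ⨯₃ v j) ⬝ᵥ v l ≠ 0 := by
  obtain ⟨i, hi⟩ := hv ![1, 0, 0] fun h => by simpa using congrFun h 0
  have hi0 : v i 0 ≠ 0 := by simpa [dotProduct, Fin.sum_univ_three] using hi
  obtain ⟨j, hj⟩ := hv (v i ⨯₃ ![0, 1, 0]) fun h => hi0 (by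
    simpa [cross_apply] using congrFun h 2)
  obtain ⟨l, hl⟩ := hv (v i ⨯₃ v j) fun h => hj (by
    rw [← tripleProduct_rotate, ← tripleProduct_rotate, tripleProduct_swap, h]
    simp)
  exact ⟨i, j, l, hl⟩

/-- A family of vectors of `k³` not contained in a union of two planes has four members no three
of which are dependent. -/
theorem exists_four_in_general_position {ι : Type*} {v : ι → Fin 3 → k}
    (hv : ∀ u u' : Fin 3 → k, u ≠ 0 → u' ≠ 0 → ∃ i, u ⬝ᵥ v i ≠ 0 ∧ u' ⬝ᵥ v i ≠ 0) :
    ∃ a b c d, (v a ⨯₃ v b) ⬝ᵥ v c ≠ 0 ∧ (v a ⨯₃ v b) ⬝ᵥ v d ≠ 0 ∧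
      (v b ⨯₃ v c) ⬝ᵥ v d ≠ 0 ∧ (v c ⨯₃ v a) ⬝ᵥ v d ≠ 0 := by
  obtain ⟨a, b, c, habc⟩ := exists_tripleProduct_ne_zero fun u hu =>
    (hv u u hu hu).imp fun _ h => h.1
  by_cases hd : ∃ d, (v a ⨯₃ v b) ⬝ᵥ v d ≠ 0 ∧
      (v b ⨯₃ v c) ⬝ᵥ v d ≠ 0 ∧ (v c ⨯₃ v a) ⬝ᵥ v d ≠ 0
  · obtain ⟨d, hd⟩ := hd
    exact ⟨a, b, c, d, habc, hd⟩
  push Not at hd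
  have hab : v a ⨯₃ v b ≠ 0 := fun h => habc (by simp [h])
  have hbc : v b ⨯₃ v c ≠ 0 := fun h => habc (by rw [← tripleProduct_rotate, h]; simp)
  have hca : v c ⨯₃ v a ≠ 0 := fun h => habc (by
    rw [← tripleProduct_rotate, ← tripleProduct_rotate, h]; simp)
  -- `d` lies on the line through `c` and `a`, and `e` on the line through `a` and `b`
  obtain ⟨d, hd₁, hd₂⟩ := hv _ _ hab hbc
  obtain ⟨e, he₁, he₂⟩ := hv _ _ hca hbc
  have hd₃ := hd d hd₁ hd₂
  have he₃ : (v a ⨯₃ v b) ⬝ᵥ v e = 0 := by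
    by_contra h
    exact he₁ (hd e h he₂)
  refine ⟨b, c, d, e, hd₂, he₂, ?_, ?_⟩
  · intro h
    have := tripleProduct_mul_swap (v a) (v c) (v b) (v d) (v e)
    simp only [h, tripleProduct_swap (v c) (v a), tripleProduct_swap (v b) (v c), hd₃] at this
    simp [he₁, hd₂] at this
  · intro h
    have := tripleProduct_mul_swap (v a) (v b) (v c) (v d) (v e)
    rw [tripleProduct_swap (v d) (v b), h, he₃] at this
    simp [hd₁, he₂] at this

end

theorem four_points_on_smooth_conic (k : Type*) [Field k] [IsAlgClosed k]
    (n : ℕ) (P : Fin n → Projectivization k (Fin 3 → k))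
    (hinj : Function.Injective P)
    (hnoconic : ¬ ∃ q : MvPolynomial (Fin 3) k,
      q ≠ 0 ∧ q.IsHomogeneous 2 ∧ ∀ i : Fin n, eval (P i).rep q = 0) :
    ∃ i₁ i₂ i₃ i₄ : Fin n,
      i₁ ≠ i₂ ∧ i₁ ≠ i₃ ∧ i₁ ≠ i₄ ∧ i₂ ≠ i₃ ∧ i₂ ≠ i₄ ∧ i₃ ≠ i₄ ∧
      ∃ q : MvPolynomial (Fin 3) k,
        q ≠ 0 ∧ q.IsHomogeneous 2 ∧
        -- the four points lie on the conic {q = 0} …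
        eval (P i₁).rep q = 0 ∧ eval (P i₂).rep q = 0 ∧
        eval (P i₃).rep q = 0 ∧ eval (P i₄).rep q = 0 ∧
        -- … which is smooth: no point of its zero locus annihilates all partial derivatives
        (∀ w : Fin 3 → k, w ≠ 0 → eval w q = 0 → ∃ j : Fin 3, eval w (pderiv j q) ≠ 0) := by
  have hv (u u' : Fin 3 → k) (hu : u ≠ 0) (hu' : u' ≠ 0) :
      ∃ i, dotProduct u (P i).rep ≠ 0 ∧ dotProduct u' (P i).rep ≠ 0 := by
    by_contra! h
    refine hnoconic ⟨linearForm u * linearForm u',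
      mul_ne_zero (linearForm_ne_zero hu) (linearForm_ne_zero hu'),
      isHomogeneous_linearForm_mul u u', fun i => ?_⟩
    rw [map_mul, eval_linearForm, eval_linearForm, mul_eq_zero]
    exact or_iff_not_imp_left.2 (h i)
  obtain ⟨a, b, c, d, habc, habd, hbcd, hcad⟩ := exists_four_in_general_position hv
  refine ⟨a, b, c, d, ?_, ?_, ?_, ?_, ?_, ?_, exists_smooth_conic habc habd hbcd hcad⟩ <;>
    rintro rfl <;>
    simp [dotProduct_comm, cross_self, dot_self_cross, dot_cross_self] at habc habd hbcd hcad
end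

section
/- Let k be a field and let p₁, …, pₙ be distinct points of ℙ²(k) such that no plane conic — i.e., the zero locus of a nonzero homogeneous quadratic form in three variables, possibly degenerate — contains all of them. Then for every index i there exist three pairwise distinct indices j₁, j₂, j₃, all different from i, such that pᵢ does not lie on any of the three lines spanned by two of the points p_{j₁}, p_{j₂}, p_{j₃}. -/
/-!
STATEMENT 15: Over any field `k`, if `p₁, …, pₙ` are distinct points of `ℙ²(k)` such that no plane
conic (the zero locus of a nonzero homogeneous quadratic form, possibly degenerate) contains all of
them, then for every index `i` there are three pairwise distinct indices `j₁, j₂, j₃`, all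
different from `i`, such that `pᵢ` does not lie on any of the three lines spanned by two of the
points `p_{j₁}, p_{j₂}, p_{j₃}` (the line spanned by two distinct points being the
projectivization of the plane in `k³` spanned by representative vectors).
-/

open MvPolynomial

/-- Any two vectors of `k³` are common zeros of some nonzero linear form; the form vanishes on
their whole span. -/
theorem exists_linear_form_vanishing_on_span_pair {k : Type*} [Field k] (u v : Fin 3 → k) :
    ∃ l : MvPolynomial (Fin 3) k, l ≠ 0 ∧ l.IsHomogeneous 1 ∧
      ∀ x ∈ Submodule.span k ({u, v} : Set (Fin 3 → k)), eval x l = 0 := by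
  classical
  have hlt : Submodule.span k ({u, v} : Set (Fin 3 → k)) < ⊤ := by
    refine lt_top_iff_ne_top.2 fun h => ?_
    have hcard := finrank_span_finset_le_card (R := k) ({u, v} : Finset (Fin 3 → k))
    rw [Set.finrank, Finset.coe_pair, h, finrank_top, Module.finrank_fin_fun] at hcard
    have := Finset.card_le_two (a := u) (b := v)
    omega
  obtain ⟨f, hf, hker⟩ := Submodule.exists_le_ker_of_lt_top _ hlt
  have heval (x : Fin 3 → k) :
      eval x (∑ i, C (f fun j => if i = j then 1 else 0) * X i : MvPolynomial (Fin 3) k) = f x := by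
    rw [LinearMap.pi_apply_eq_sum_univ f x]
    simp [mul_comm]
  refine ⟨∑ i, C (f fun j => if i = j then 1 else 0) * X i, fun h => hf ?_, ?_, fun x hx => ?_⟩
  · refine LinearMap.ext fun x => ?_
    simpa [h] using (heval x).symm
  · exact IsHomogeneous.sum _ _ _ fun i _ => isHomogeneous_C_mul_X _ i
  · rw [heval]
    exact hker hx

/-- If no conic contains all the vectors `w j`, then two planes cannot cover them. -/
theorem exists_notMem_span_pair_of_no_conic {k ι : Type*} [Field k] {w : ι → Fin 3 → k}
    (hw : ¬ ∃ q : MvPolynomial (Fin 3) k, q ≠ 0 ∧ q.IsHomogeneous 2 ∧ ∀ j, eval (w j) q = 0)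
    (p u v : Fin 3 → k) :
    ∃ j, w j ∉ Submodule.span k {p, u} ∧ w j ∉ Submodule.span k {p, v} := by
  by_contra! h
  obtain ⟨l, hl, hl1, hlz⟩ := exists_linear_form_vanishing_on_span_pair p u
  obtain ⟨m, hm, hm1, hmz⟩ := exists_linear_form_vanishing_on_span_pair p v
  refine hw ⟨l * m, mul_ne_zero hl hm, hl1.mul hm1, fun j => ?_⟩
  rw [map_mul, mul_eq_zero]
  by_cases hj : w j ∈ Submodule.span k {p, u}
  · exact .inl (hlz _ hj)
  · exact .inr (hmz _ (h j hj))

theorem notMem_span_pair_of_notMem_span_pair {k V : Type*} [Field k] [AddCommGroup V] [Module k V]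
    {p y z : V} (hp : p ≠ 0) (hy : y ∉ Submodule.span k {p}) (hz : z ∉ Submodule.span k {p, y}) :
    p ∉ Submodule.span k {y, z} := by
  intro h
  have hpy : p ∉ Submodule.span k {y} := fun hpy => by
    rw [← insert_empty_eq] at hpy hy
    exact hy (mem_span_insert_exchange hpy (by simpa using hp))
  rw [Set.pair_comm] at h
  exact hz (mem_span_insert_exchange h hpy)

theorem point_off_three_lines (k : Type*) [Field k]
    (n : ℕ) (P : Fin n → Projectivization k (Fin 3 → k))
    (hinj : Function.Injective P)
    (hnoconic : ¬ ∃ q : MvPolynomial (Fin 3) k,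
      q ≠ 0 ∧ q.IsHomogeneous 2 ∧ ∀ i : Fin n, eval (P i).rep q = 0) :
    ∀ i : Fin n, ∃ j₁ j₂ j₃ : Fin n,
      j₁ ≠ j₂ ∧ j₁ ≠ j₃ ∧ j₂ ≠ j₃ ∧ j₁ ≠ i ∧ j₂ ≠ i ∧ j₃ ≠ i ∧
      (P i).rep ∉ Submodule.span k ({(P j₁).rep, (P j₂).rep} : Set (Fin 3 → k)) ∧
      (P i).rep ∉ Submodule.span k ({(P j₁).rep, (P j₃).rep} : Set (Fin 3 → k)) ∧
      (P i).rep ∉ Submodule.span k ({(P j₂).rep, (P j₃).rep} : Set (Fin 3 → k)) := by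
  intro i
  have hp := (P i).rep_nonzero
  obtain ⟨j₁, h₁, -⟩ := exists_notMem_span_pair_of_no_conic hnoconic (P i).rep (P i).rep (P i).rep
  obtain ⟨j₂, h₂, -⟩ := exists_notMem_span_pair_of_no_conic hnoconic (P i).rep (P j₁).rep (P j₁).rep
  obtain ⟨j₃, h₃₁, h₃₂⟩ :=
    exists_notMem_span_pair_of_no_conic hnoconic (P i).rep (P j₁).rep (P j₂).rep
  have left_mem (u v : Fin 3 → k) : u ∈ Submodule.span k {u, v} :=
    Submodule.subset_span (Set.mem_insert u {v})
  have right_mem (u v : Fin 3 → k) : v ∈ Submodule.span k {u, v} :=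
    Submodule.subset_span (Set.mem_insert_of_mem u rfl)
  have hs₁ : (P j₁).rep ∉ Submodule.span k {(P i).rep} := by rwa [Set.pair_eq_singleton] at h₁
  have hs₂ : (P j₂).rep ∉ Submodule.span k {(P i).rep} := fun h =>
    h₂ (Submodule.span_mono (by simp) h)
  refine ⟨j₁, j₂, j₃, ?_, ?_, ?_, ?_, ?_, ?_,
    notMem_span_pair_of_notMem_span_pair hp hs₁ h₂,
    notMem_span_pair_of_notMem_span_pair hp hs₁ h₃₁,
    notMem_span_pair_of_notMem_span_pair hp hs₂ h₃₂⟩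
  · rintro rfl; exact h₂ (right_mem _ _)
  · rintro rfl; exact h₃₁ (right_mem _ _)
  · rintro rfl; exact h₃₂ (right_mem _ _)
  · rintro rfl; exact h₁ (left_mem _ _)
  · rintro rfl; exact h₂ (left_mem _ _)
  · rintro rfl; exact h₃₁ (left_mem _ _)
end
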